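/- For every point (i,j) in the three-quadrant cone C, the formal power series F(t) = ∑_{n ≥ 0} c_{i,j}(n)·t^n in ℚ[[t]], where c_{i,j}(n) is the number of square-lattice walks of length n from (−1,0) to (i,j) confined to C, is algebraic over the polynomial ring ℚ[t]: there exists a nonzero polynomial P in one variable with coefficients in ℚ[t] such that P(F) = 0. -/

import Mathlib

/-- Square-lattice steps. -/
def squareSteps : Set (ℤ × ℤ) := {(1,0), (-1,0), (0,1), (0,-1)}

/-- Diagonal-lattice steps. -/
def diagSteps : Set (ℤ × ℤ) := {(1,1), (1,-1), (-1,1), (-1,-1)}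

/-- The three-quadrant cone `C = {(i,j) : i ≥ 0 or j ≥ 0}`. -/
def coneC : Set (ℤ × ℤ) := {p | 0 ≤ p.1 ∨ 0 ≤ p.2}

/-- The quadrant `Q = {(i,j) : i ≥ 0 and j ≥ 0}`. -/
def quadQ : Set (ℤ × ℤ) := {p | 0 ≤ p.1 ∧ 0 ≤ p.2}

/-- Number of walks of length `n` with steps in `steps`, from `a` to `b`,
confined to `region`. -/
noncomputable def walkCount (steps region : Set (ℤ × ℤ)) (a b : ℤ × ℤ) (n : ℕ) : ℕ :=
  Nat.card {w : Fin (n+1) → ℤ × ℤ //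
    w 0 = a ∧ w (Fin.last n) = b ∧
    (∀ k : Fin n, w k.succ - w k.castSucc ∈ steps) ∧
    (∀ k, w k ∈ region)}

open PowerSeries

section Walks

variable {steps region : Set (ℤ × ℤ)} {a b : ℤ × ℤ} {n : ℕ}

open Classical in
theorem walkCount_zero :
    walkCount steps region a b 0 = if a = b ∧ a ∈ region then 1 else 0 := by
  unfold walkCount
  split_ifs with h
  · obtain ⟨rfl, h⟩ := h
    rw [Nat.card_eq_one_iff_unique]
    refine ⟨⟨fun u v => ?_⟩, ⟨⟨fun _ => a, rfl, rfl, fun k => k.elim0, fun _ => h⟩⟩⟩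
    ext1
    funext k
    rw [Fin.fin_one_eq_zero k, u.2.1, v.2.1]
  · rw [Nat.card_eq_zero]
    left
    refine ⟨fun ⟨w, h0, h1, _, h2⟩ => h ⟨?_, ?_⟩⟩
    · rw [← h0, ← h1]; rfl
    · rw [← h0]; exact h2 0

theorem walkCount_eq_zero_of_notMem (hb : b ∉ region) : walkCount steps region a b n = 0 := by
  unfold walkCount
  rw [Nat.card_eq_zero]
  left
  refine ⟨fun ⟨w, _, h1, _, h2⟩ => hb ?_⟩
  rw [← h1]
  exact h2 _

/-- Removing the last point of a walk. -/
def walkInitEquiv (hb : b ∈ region) :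
    {w : Fin (n + 2) → ℤ × ℤ // w 0 = a ∧ w (Fin.last (n + 1)) = b ∧
      (∀ k : Fin (n + 1), w k.succ - w k.castSucc ∈ steps) ∧ ∀ k, w k ∈ region} ≃
    {w : Fin (n + 1) → ℤ × ℤ // w 0 = a ∧ b - w (Fin.last n) ∈ steps ∧
      (∀ k : Fin n, w k.succ - w k.castSucc ∈ steps) ∧ ∀ k, w k ∈ region} where
  toFun w := ⟨fun k => w.1 k.castSucc, w.2.1, by
      have h := w.2.2.2.1 (Fin.last n)
      rwa [Fin.succ_last, w.2.2.1] at h,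
    fun k => w.2.2.2.1 k.castSucc, fun k => w.2.2.2.2 _⟩
  invFun w := ⟨Fin.snoc (α := fun _ => ℤ × ℤ) w.1 b, by
      have h := Fin.snoc_castSucc (α := fun _ => ℤ × ℤ) b w.1 0
      exact h.trans w.2.1, by simp, fun k => by
      refine Fin.lastCases ?_ (fun k => ?_) k
      · rw [Fin.succ_last, Fin.snoc_last, Fin.snoc_castSucc]
        exact w.2.2.1
      · rw [Fin.snoc_castSucc, Fin.succ_castSucc, Fin.snoc_castSucc]
        exact w.2.2.2.1 k, fun k => by
      refine Fin.lastCases ?_ (fun k => ?_) k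
      · rwa [Fin.snoc_last]
      · rw [Fin.snoc_castSucc]
        exact w.2.2.2.2 k⟩
  left_inv w := by
    ext1
    funext k
    refine Fin.lastCases ?_ (fun k => ?_) k
    · simp [w.2.2.1]
    · simp
  right_inv w := by
    ext1
    funext k
    simp

/-- Grouping the truncated walks by the step that has been removed. -/
def walkFiberEquiv (s : steps) :
    {x : {w : Fin (n + 1) → ℤ × ℤ // w 0 = a ∧ b - w (Fin.last n) ∈ steps ∧
      (∀ k : Fin n, w k.succ - w k.castSucc ∈ steps) ∧ ∀ k, w k ∈ region} //
        (⟨b - x.1 (Fin.last n), x.2.2.1⟩ : steps) = s} ≃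
    {w : Fin (n + 1) → ℤ × ℤ // w 0 = a ∧ w (Fin.last n) = b - s ∧
      (∀ k : Fin n, w k.succ - w k.castSucc ∈ steps) ∧ ∀ k, w k ∈ region} where
  toFun x := ⟨x.1.1, x.1.2.1, by
    have h := congrArg Subtype.val x.2
    simp only at h
    rw [← h, sub_sub_cancel], x.1.2.2.2⟩
  invFun w := ⟨⟨w.1, w.2.1, by rw [w.2.2.1]; simp, w.2.2.2⟩, by
    ext1
    simp [w.2.2.1]⟩
  left_inv _ := rfl
  right_inv _ := rfl

theorem finite_walks (hs : steps.Finite) (n : ℕ) : ∀ b : ℤ × ℤ,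
    Finite {w : Fin (n + 1) → ℤ × ℤ // w 0 = a ∧ w (Fin.last n) = b ∧
      (∀ k : Fin n, w k.succ - w k.castSucc ∈ steps) ∧ ∀ k, w k ∈ region} := by
  induction n with
  | zero =>
    intro b
    refine @Finite.of_subsingleton _ ⟨fun u v => ?_⟩
    ext1
    funext k
    rw [Fin.fin_one_eq_zero k, u.2.1, v.2.1]
  | succ n ih =>
    intro b
    by_cases hb : b ∈ region
    · have := hs.to_subtype
      have (s : steps) := Finite.of_equiv _
        (walkFiberEquiv (a := a) (b := b) (region := region) (n := n) s).symm
      exact Finite.of_equiv _ ((Equiv.sigmaFiberEquiv fun x =>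
        (⟨b - x.1 (Fin.last n), x.2.2.1⟩ : steps)).trans (walkInitEquiv hb).symm)
    · refine @Finite.of_subsingleton _ ⟨fun u v => ?_⟩
      exact absurd (u.2.2.1 ▸ u.2.2.2.2 (Fin.last _)) hb

theorem walkCount_succ {S : Finset (ℤ × ℤ)} (hb : b ∈ region) :
    walkCount (S : Set (ℤ × ℤ)) region a b (n + 1) =
      ∑ s ∈ S, walkCount (S : Set (ℤ × ℤ)) region a (b - s) n := by
  have hfin := finite_walks (a := a) (region := region) S.finite_toSet n
  have (s : (S : Set (ℤ × ℤ))) := Finite.of_equiv _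
    (walkFiberEquiv (a := a) (b := b) (region := region) (n := n) s).symm
  unfold walkCount
  rw [Nat.card_congr ((walkInitEquiv hb).trans (Equiv.sigmaFiberEquiv fun x =>
    (⟨b - x.1 (Fin.last n), x.2.2.1⟩ : (S : Set (ℤ × ℤ)))).symm), Nat.card_sigma,
    ← Finset.sum_coe_sort S]
  exact Finset.sum_congr rfl fun s _ => Nat.card_congr (walkFiberEquiv s)

end Walks

/-- The generating function of the walks in the three-quadrant cone from `(-1, 0)` to `(i, j)`. -/
noncomputable def coneGF (i j : ℤ) : ℚ⟦X⟧ :=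
  PowerSeries.mk fun n => (walkCount squareSteps coneC (-1, 0) (i, j) n : ℚ)

theorem coneGF_of_neg {i j : ℤ} (hi : i < 0) (hj : j < 0) : coneGF i j = 0 := by
  ext n
  simp only [coneGF, coeff_mk, map_zero, Nat.cast_eq_zero]
  exact walkCount_eq_zero_of_notMem (by simp [coneC, hi, hj])

theorem coneGF_eq {i j : ℤ} (h : 0 ≤ i ∨ 0 ≤ j) :
    coneGF i j = (if i = -1 ∧ j = 0 then 1 else 0) +
      X * (coneGF (i - 1) j + coneGF (i + 1) j + coneGF i (j - 1) + coneGF i (j + 1)) := by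
  have hS : squareSteps =
      ((({(1, 0), (-1, 0), (0, 1), (0, -1)} : Finset (ℤ × ℤ))) : Set (ℤ × ℤ)) := by
    simp [squareSteps]
  ext n
  cases n with
  | zero =>
    simp only [coneGF, coeff_mk, map_add, coeff_zero_X_mul, walkCount_zero, add_zero]
    have : ((-1 : ℤ), (0 : ℤ)) ∈ coneC := by simp [coneC]
    by_cases h' : i = -1 ∧ j = 0
    · simp [h', this]
    · rw [if_neg h', if_neg (by rintro ⟨h1, -⟩; simp only [Prod.mk.injEq] at h1; omega)]
      simp
  | succ n =>
    have : coeff (n + 1) (if i = -1 ∧ j = 0 then 1 else 0 : ℚ⟦X⟧) = 0 := by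
      split_ifs <;> simp [coeff_one]
    rw [map_add, this, coeff_succ_X_mul]
    simp only [coneGF, coeff_mk, map_add]
    rw [hS, walkCount_succ (by exact h)]
    simp
    ring

theorem X_pow_dvd_coneGF_left (k : ℕ) : ∀ {i : ℤ} (j : ℤ), i ≤ -1 - k → X ^ k ∣ coneGF i j := by
  induction k with
  | zero => simp
  | succ k ih =>
    intro i j h
    push_cast at h
    by_cases hj : 0 ≤ j
    · rw [coneGF_eq (Or.inr hj), if_neg (by omega), zero_add, pow_succ']
      exact mul_dvd_mul_left X (dvd_add (dvd_add (dvd_add (ih _ (by omega)) (ih _ (by omega)))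
        (ih _ (by omega))) (ih _ (by omega)))
    · rw [coneGF_of_neg (by omega) (by omega)]
      exact dvd_zero _

theorem X_pow_dvd_coneGF_right (k : ℕ) : ∀ (i : ℤ) {j : ℤ}, j ≤ -k → X ^ k ∣ coneGF i j := by
  induction k with
  | zero => simp
  | succ k ih =>
    intro i j h
    push_cast at h
    by_cases hi : 0 ≤ i
    · rw [coneGF_eq (Or.inl hi), if_neg (by omega), zero_add, pow_succ']
      exact mul_dvd_mul_left X (dvd_add (dvd_add (dvd_add (ih _ (by omega)) (ih _ (by omega)))
        (ih _ (by omega))) (ih _ (by omega)))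
    · rw [coneGF_of_neg (by omega) (by omega)]
      exact dvd_zero _

section Diagonal

variable {R : Type*} [CommRing R]

/-- The ring homomorphism `F(X, Y) ↦ F(X, X)` on bivariate power series. -/
noncomputable def diagHom (R : Type*) [CommRing R] : R⟦X⟧⟦X⟧ →+* R⟦X⟧ where
  toFun F := PowerSeries.mk fun n => ∑ p ∈ Finset.HasAntidiagonal.antidiagonal n, coeff p.2 (coeff p.1 F)
  map_zero' := by ext n; simp
  map_add' F G := by ext n; simp [Finset.sum_add_distrib]
  map_one' := by
    ext n
    rw [coeff_mk, Finset.sum_eq_single (0, n)]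
    · simp
    · rintro ⟨k, l⟩ h h'
      rw [Finset.HasAntidiagonal.mem_antidiagonal] at h
      have : k ≠ 0 := by rintro rfl; simp at h; exact h' (by rw [h])
      simp [coeff_one, this]
    · simp
  map_mul' F G := by
    ext n
    simp only [coeff_mk, coeff_mul, map_sum, Finset.sum_mul_sum, ← Finset.sum_product']
    simp only [Finset.sum_sigma']
    refine Finset.sum_nbij'
      (fun q => ⟨(q.2.1.1 + q.2.2.1, q.2.1.2 + q.2.2.2),
        ((q.2.1.1, q.2.2.1), (q.2.1.2, q.2.2.2))⟩)
      (fun q => ⟨(q.2.1.1 + q.2.2.1, q.2.1.2 + q.2.2.2),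
        ((q.2.1.1, q.2.2.1), (q.2.1.2, q.2.2.2))⟩) ?_ ?_ ?_ ?_ ?_
    · rintro ⟨⟨k, l⟩, ⟨k1, k2⟩, ⟨l1, l2⟩⟩ h
      simp only [Finset.mem_sigma, Finset.mem_product, Finset.HasAntidiagonal.mem_antidiagonal] at h ⊢
      obtain ⟨h, rfl, rfl⟩ := h
      exact ⟨by omega, trivial, trivial⟩
    · rintro ⟨⟨k, l⟩, ⟨k1, k2⟩, ⟨l1, l2⟩⟩ h
      simp only [Finset.mem_sigma, Finset.mem_product, Finset.HasAntidiagonal.mem_antidiagonal] at h ⊢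
      obtain ⟨h, rfl, rfl⟩ := h
      exact ⟨by omega, trivial, trivial⟩
    · rintro ⟨⟨k, l⟩, ⟨k1, k2⟩, ⟨l1, l2⟩⟩ h
      simp only [Finset.mem_sigma, Finset.mem_product, Finset.HasAntidiagonal.mem_antidiagonal] at h
      obtain ⟨-, rfl, rfl⟩ := h
      rfl
    · rintro ⟨⟨k, l⟩, ⟨k1, k2⟩, ⟨l1, l2⟩⟩ h
      simp only [Finset.mem_sigma, Finset.mem_product, Finset.HasAntidiagonal.mem_antidiagonal] at h
      obtain ⟨-, rfl, rfl⟩ := h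
      rfl
    · rintro ⟨⟨k, l⟩, ⟨k1, k2⟩, ⟨l1, l2⟩⟩ h
      rfl

theorem coeff_diagHom (F : R⟦X⟧⟦X⟧) (n : ℕ) :
    coeff n (diagHom R F) = ∑ p ∈ Finset.HasAntidiagonal.antidiagonal n, coeff p.2 (coeff p.1 F) := by
  change coeff n (PowerSeries.mk (R := R) fun n =>
    ∑ p ∈ Finset.HasAntidiagonal.antidiagonal n, coeff p.2 (coeff p.1 F)) = _
  rw [coeff_mk]

@[simp]
theorem diagHom_C (a : R⟦X⟧) : diagHom R (C a) = a := by
  ext n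
  rw [coeff_diagHom, Finset.sum_eq_single (0, n)]
  · simp
  · rintro ⟨k, l⟩ h h'
    rw [Finset.HasAntidiagonal.mem_antidiagonal] at h
    have : k ≠ 0 := by rintro rfl; simp at h; exact h' (by rw [h])
    simp [coeff_C, this]
  · simp

@[simp]
theorem diagHom_X : diagHom R X = X := by
  ext n
  rw [coeff_diagHom, coeff_X]
  split_ifs with h
  · subst h
    simp [Finset.Nat.antidiagonal_succ]
  · refine Finset.sum_eq_zero ?_
    rintro ⟨k, l⟩ h'
    rw [Finset.HasAntidiagonal.mem_antidiagonal] at h'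
    rw [coeff_X]
    split_ifs with hk
    · rw [coeff_one, if_neg (by simp only at *; omega)]
    · simp

/-- The ring homomorphism `F(X, Y) ↦ F(X, c(X) X)` on bivariate power series. -/
noncomputable def evalMulX (c : R⟦X⟧) : R⟦X⟧⟦X⟧ →+* R⟦X⟧ :=
  (diagHom R).comp (rescale c)

@[simp]
theorem evalMulX_C (c a : R⟦X⟧) : evalMulX c (C a) = a := by
  have : rescale c (C a) = C a := by
    ext1 n
    rw [coeff_rescale, coeff_C]
    split_ifs with h <;> simp [h]
  rw [evalMulX, RingHom.comp_apply, this, diagHom_C]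

@[simp]
theorem evalMulX_X (c : R⟦X⟧) : evalMulX c X = c * X := by
  simp [evalMulX]

theorem constantCoeff_evalMulX (c : R⟦X⟧) (F : R⟦X⟧⟦X⟧) :
    constantCoeff (evalMulX c F) = constantCoeff (constantCoeff F) := by
  rw [← coeff_zero_eq_constantCoeff_apply, evalMulX, RingHom.comp_apply, coeff_diagHom]
  simp

end Diagonal

section Kernel

/-- The kernel `xy - t(1 + y)(1 + x²y)` in the ring of series in `x`, `y` over `ℚ⟦t⟧`,
where `y` is the outer variable. -/
noncomputable def kernelPoly : ℚ⟦X⟧⟦X⟧⟦X⟧ :=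
  C X * X - C (C X) * (1 + X) * (1 + C X ^ 2 * X)

/-- The embedding of series in `y` into series in `x` and `y`. -/
noncomputable abbrev yEmb : ℚ⟦X⟧⟦X⟧ →+* ℚ⟦X⟧⟦X⟧⟦X⟧ := PowerSeries.map C

theorem dvd_of_forall_coeff_dvd {R : Type*} [CommRing R] {r : R} {f : R⟦X⟧}
    (h : ∀ n, r ∣ coeff n f) : C r ∣ f := by
  choose g hg using h
  refine ⟨PowerSeries.mk g, ?_⟩
  ext n
  rw [hg, coeff_C_mul, coeff_mk]

theorem coeff_dvd_of_C_dvd {R : Type*} [CommRing R] {r : R} {f : R⟦X⟧} (h : C r ∣ f) (n : ℕ) :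
    r ∣ coeff n f := by
  obtain ⟨g, rfl⟩ := h
  rw [coeff_C_mul]
  exact dvd_mul_right _ _

theorem X_dvd_of_X_dvd_kernelPoly_mul {H : ℚ⟦X⟧⟦X⟧⟦X⟧} (h : X ∣ kernelPoly * H) : X ∣ H := by
  rw [X_dvd_iff] at h ⊢
  rw [map_mul] at h
  refine (mul_eq_zero.1 h).resolve_left ?_
  have : constantCoeff kernelPoly = -C (X : ℚ⟦X⟧) := by simp [kernelPoly]
  rw [this]
  refine neg_ne_zero.2 ?_
  rw [Ne, map_eq_zero_iff _ C_injective]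
  exact X_ne_zero

theorem CX_dvd_of_CX_dvd_kernelPoly_mul {H : ℚ⟦X⟧⟦X⟧⟦X⟧} (h : C X ∣ kernelPoly * H) :
    C X ∣ H := by
  have key (F : ℚ⟦X⟧⟦X⟧⟦X⟧) : C X ∣ F ↔ PowerSeries.map constantCoeff F = 0 := by
    refine ⟨?_, fun h => dvd_of_forall_coeff_dvd fun n => ?_⟩
    · rintro ⟨G, rfl⟩
      simp
    · rw [X_dvd_iff, ← coeff_map, h, map_zero]
  rw [key] at h ⊢
  rw [map_mul] at h
  refine (mul_eq_zero.1 h).resolve_left ?_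
  intro h0
  have := congrArg (coeff 0) h0
  simp [kernelPoly] at this

theorem dvd_of_pow_mul_eq_kernelPoly_mul (k l : ℕ) {F H : ℚ⟦X⟧⟦X⟧⟦X⟧}
    (h : C X ^ k * X ^ l * F = kernelPoly * H) : kernelPoly ∣ F := by
  induction k generalizing H with
  | succ k ih =>
    obtain ⟨H', rfl⟩ := CX_dvd_of_CX_dvd_kernelPoly_mul
      ⟨C X ^ k * X ^ l * F, by rw [← h]; ring⟩
    have hx : (C X : ℚ⟦X⟧⟦X⟧⟦X⟧) ≠ 0 := by
      rw [Ne, map_eq_zero_iff _ C_injective]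
      exact X_ne_zero
    exact ih (H := H') (mul_left_cancel₀ hx (by linear_combination h))
  | zero =>
    induction l generalizing H with
    | zero => exact ⟨H, by simpa using h⟩
    | succ l ih =>
      obtain ⟨H', rfl⟩ := X_dvd_of_X_dvd_kernelPoly_mul (H := H) ⟨X ^ l * F, by rw [← h]; ring⟩
      exact ih (H := H') (mul_left_cancel₀ X_ne_zero (by linear_combination h))

theorem eq_C_of_kernelPoly_dvd {f g : ℚ⟦X⟧⟦X⟧} (h : kernelPoly ∣ C f - yEmb g) :
    f = C (constantCoeff f) ∧ g = C (constantCoeff f) := by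
  obtain ⟨H, hH⟩ := h
  have hdvd (N : ℕ) : (C (C (X ^ N)) : ℚ⟦X⟧⟦X⟧⟦X⟧) ∣ H := by
    induction N with
    | zero => simp
    | succ N ih =>
      obtain ⟨G, hG⟩ := ih
      refine dvd_of_forall_coeff_dvd fun j => dvd_of_forall_coeff_dvd fun i => ?_
      have h1 : C X * (X * H) - (C f - yEmb g) =
          C (C (X ^ (N + 1))) * ((1 + X) * (1 + C X ^ 2 * X) * G) := by
        rw [hH, kernelPoly, pow_succ X N, map_mul, map_mul]
        linear_combination (C (C X) * (1 + X) * (1 + C X ^ 2 * X)) * hG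
      have h2 := coeff_dvd_of_C_dvd (coeff_dvd_of_C_dvd ⟨_, h1⟩ (j + 1)) (i + 1)
      simpa [coeff_C] using h2
  have hH0 : H = 0 := by
    ext j i n
    obtain ⟨G, rfl⟩ := hdvd (n + 1)
    rw [coeff_C_mul, coeff_C_mul, coeff_X_pow_mul', if_neg (by omega)]
    simp
  rw [hH0, mul_zero] at hH
  have hf : f = C (constantCoeff g) := by
    have := congrArg constantCoeff hH
    rw [map_zero, map_sub, constantCoeff_C, ← coeff_zero_eq_constantCoeff_apply, coeff_map,
      coeff_zero_eq_constantCoeff_apply, sub_eq_zero] at this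
    exact this
  have h0 : constantCoeff f = constantCoeff g := by rw [hf]; simp
  refine ⟨by rw [h0, ← hf], ?_⟩
  ext1 n
  have := congrArg (fun F => constantCoeff (coeff n F)) (sub_eq_zero.1 hH)
  rw [h0]
  simp only [coeff_C, coeff_map, apply_ite constantCoeff, map_zero, constantCoeff_C] at this ⊢
  rw [← this, h0]

end Kernel

section CoeffsIn

variable {A : Type*} [CommRing A] (S : Subring A)

/-- Series whose first `k` coefficients belong to a subring. -/
def coeffsIn (k : ℕ) : Subring A⟦X⟧ where
  carrier := {f | ∀ j < k, coeff j f ∈ S}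
  mul_mem' {f g} hf hg j hj := by
    rw [coeff_mul]
    refine S.sum_mem fun p hp => ?_
    rw [Finset.HasAntidiagonal.mem_antidiagonal] at hp
    exact S.mul_mem (hf _ (by omega)) (hg _ (by omega))
  one_mem' j _ := by
    rw [coeff_one]
    split_ifs
    exacts [S.one_mem, S.zero_mem]
  add_mem' hf hg j hj := by
    rw [map_add]
    exact S.add_mem (hf j hj) (hg j hj)
  zero_mem' j _ := by
    rw [map_zero]
    exact S.zero_mem
  neg_mem' hf j hj := by
    rw [map_neg]
    exact S.neg_mem (hf j hj)

variable {S} {k : ℕ} {f g : A⟦X⟧}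

theorem X_mul_mem_coeffsIn (hf : f ∈ coeffsIn S k) : X * f ∈ coeffsIn S (k + 1) := by
  rintro (_ | j) hj
  · rw [coeff_zero_X_mul]
    exact S.zero_mem
  · rw [coeff_succ_X_mul]
    exact hf j (by omega)

theorem mem_coeffsIn_of_X_mul (hf : X * f ∈ coeffsIn S (k + 1)) : f ∈ coeffsIn S k := by
  intro j hj
  rw [← coeff_succ_X_mul]
  exact hf _ (by omega)

theorem C_mem_coeffsIn {a : A} (ha : a ∈ S) : C a ∈ coeffsIn S k := by
  intro j _
  rw [coeff_C]
  split_ifs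
  exacts [ha, S.zero_mem]

theorem X_mem_coeffsIn : X ∈ coeffsIn S k := by
  intro j _
  rw [coeff_X]
  split_ifs
  exacts [S.one_mem, S.zero_mem]

theorem coeffsIn_anti {l : ℕ} (h : l ≤ k) (hf : f ∈ coeffsIn S k) : f ∈ coeffsIn S l :=
  fun j hj => hf j (by omega)

theorem mem_coeffsIn_of_C_mul (hS : ∀ a b : A, a ∈ S → a ≠ 0 → a * b ∈ S → b ∈ S) {a : A}
    (ha : a ∈ S) (ha0 : a ≠ 0) (hf : C a * f ∈ coeffsIn S k) : f ∈ coeffsIn S k := by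
  intro j hj
  have := hf j hj
  rw [coeff_C_mul] at this
  exact hS a _ ha ha0 this

theorem mem_coeffsIn_of_mul (hS : ∀ a b : A, a ∈ S → a ≠ 0 → a * b ∈ S → b ∈ S)
    (hf : ∀ k, f ∈ coeffsIn S k) (hf0 : constantCoeff f ≠ 0)
    (h : ∀ k, f * g ∈ coeffsIn S k) (k : ℕ) : g ∈ coeffsIn S k := by
  induction k with
  | zero => intro j hj; omega
  | succ k ih =>
    obtain ⟨f', hf'⟩ : ∃ f', f = C (constantCoeff f) + X * f' :=
      ⟨_, by rw [add_comm]; exact eq_X_mul_shift_add_const f⟩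
    have hc : constantCoeff f ∈ S := by
      rw [← coeff_zero_eq_constantCoeff_apply]
      exact hf 1 0 one_pos
    refine mem_coeffsIn_of_C_mul hS hc hf0 ?_
    have hX : X * f' ∈ coeffsIn S (k + 1) := by
      rw [show X * f' = f - C (constantCoeff f) by linear_combination -hf']
      exact sub_mem (hf _) (C_mem_coeffsIn hc)
    have := X_mul_mem_coeffsIn (mul_mem (mem_coeffsIn_of_X_mul hX) ih)
    rw [show C (constantCoeff f) * g = f * g - X * (f' * g) by linear_combination -g * hf']
    exact sub_mem (h _) this

theorem mem_coeffsIn_of_sq (hS : ∀ a b : A, a ∈ S → a ≠ 0 → a * b ∈ S → b ∈ S)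
    (hf0 : constantCoeff f ∈ S) (hf2 : 2 * constantCoeff f ≠ 0)
    (h : ∀ k, f ^ 2 ∈ coeffsIn S k) (k : ℕ) : f ∈ coeffsIn S k := by
  obtain ⟨f', hf'⟩ : ∃ f', f = C (constantCoeff f) + X * f' :=
      ⟨_, by rw [add_comm]; exact eq_X_mul_shift_add_const f⟩
  have aux (k) : f' ∈ coeffsIn S k := by
    induction k with
    | zero => intro j hj; omega
    | succ k ih =>
      refine mem_coeffsIn_of_X_mul (mem_coeffsIn_of_C_mul hS
        (a := 2 * constantCoeff f) ?_ hf2 ?_)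
      · rw [two_mul]
        exact S.add_mem hf0 hf0
      · rw [show C (2 * constantCoeff f) * (X * f') =
          f ^ 2 - C (constantCoeff f) ^ 2 - X * (X * (f' ^ 2)) by
            rw [map_mul, show (C (2 : A) : A⟦X⟧) = 2 from map_ofNat _ 2]
            linear_combination -(f + C (constantCoeff f) + X * f') * hf']
        exact sub_mem (sub_mem (h _) (pow_mem (C_mem_coeffsIn hf0) _))
          (X_mul_mem_coeffsIn (X_mul_mem_coeffsIn (pow_mem ih 2)))
  rw [hf']
  exact add_mem (C_mem_coeffsIn hf0) (coeffsIn_anti k.le_succ (X_mul_mem_coeffsIn (aux k)))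

end CoeffsIn

section KernelEquation

/-- The combination of the two reflected cone series, in the coordinates `a = j - i - 1`, `b = j`. -/
noncomputable def foldGF (ε : ℚ⟦X⟧) (a b : ℤ) : ℚ⟦X⟧ :=
  coneGF (b - a - 1) b + ε * coneGF b (b - a - 1)

theorem foldGF_eq (ε : ℚ⟦X⟧) {a b : ℤ} (hb : 0 ≤ b) :
    foldGF ε a b = (if a = 0 ∧ b = 0 then 1 else 0) + X * (foldGF ε (a + 1) b +
      foldGF ε (a - 1) b + foldGF ε (a - 1) (b - 1) + foldGF ε (a + 1) (b + 1)) := by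
  have h1 := coneGF_eq (i := b - a - 1) (j := b) (Or.inr hb)
  have h2 := coneGF_eq (i := b) (j := b - a - 1) (Or.inl hb)
  rw [if_neg (by omega)] at h2
  have h3 : (b - a - 1 = -1 ∧ b = 0) ↔ (a = 0 ∧ b = 0) := by omega
  simp only [h3] at h1
  simp only [foldGF]
  rw [h1, h2, show b - (a + 1) - 1 = b - a - 1 - 1 by ring, show b - (a - 1) - 1 = b - a - 1 + 1 by
    ring, show b - 1 - (a - 1) - 1 = b - a - 1 by ring, show b + 1 - (a + 1) - 1 = b - a - 1 by ring]
  ring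

theorem foldGF_neg_right (ε : ℚ⟦X⟧) {a : ℤ} (ha : -1 ≤ a) : foldGF ε a (-1) = 0 := by
  rw [foldGF, coneGF_of_neg (by omega) (by omega), coneGF_of_neg (by omega) (by omega)]
  ring

theorem X_pow_dvd_foldGF (ε : ℚ⟦X⟧) (a : ℕ) : X ^ a ∣ foldGF ε a 0 :=
  dvd_add (X_pow_dvd_coneGF_left _ _ (by omega))
    (dvd_mul_of_dvd_right (X_pow_dvd_coneGF_right _ _ (by omega)) _)

/-- The series `∑ q(a, 0) xᵃ` for `q = foldGF ε`. -/
noncomputable def foldX (ε : ℚ⟦X⟧) : ℚ⟦X⟧⟦X⟧ := PowerSeries.mk fun a => foldGF ε a 0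

/-- The series `∑ q(a, b) yᵇ` for `q = foldGF ε`. -/
noncomputable def foldY (ε : ℚ⟦X⟧) (a : ℤ) : ℚ⟦X⟧⟦X⟧ := PowerSeries.mk fun b => foldGF ε a b

/-- The series `∑ q(a, b) xᵃ yᵇ` for `q = foldGF ε`. -/
noncomputable def foldXY (ε : ℚ⟦X⟧) : ℚ⟦X⟧⟦X⟧⟦X⟧ :=
  PowerSeries.mk fun b => PowerSeries.mk fun a => foldGF ε a b

theorem kernelPoly_mul_foldXY (ε : ℚ⟦X⟧) :
    kernelPoly * foldXY ε = C X * X - C (C X) * C (foldX ε)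
      - C (C X) * (1 + X) * yEmb (foldY ε 0) + C (C (X * foldGF ε 0 0))
      + C (C X) * C X * X * (1 + X) * yEmb (foldY ε (-1)) := by
  rw [show kernelPoly * foldXY ε = X * (C X * foldXY ε) - C (C X) * foldXY ε
    - X * (C (C X) * foldXY ε) - X * (C X * (C X * (C (C X) * foldXY ε)))
    - X * (X * (C X * (C X * (C (C X) * foldXY ε)))) by rw [kernelPoly]; ring,
    show C X * X - C (C X) * C (foldX ε)
      - C (C X) * (1 + X) * yEmb (foldY ε 0) + C (C (X * foldGF ε 0 0))
      + C (C X) * C X * X * (1 + X) * yEmb (foldY ε (-1)) = X * C X - C (C X) * C (foldX ε)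
      - C (C X) * yEmb (foldY ε 0) - X * (C (C X) * yEmb (foldY ε 0)) + C (C (X * foldGF ε 0 0))
      + X * (C X * (C (C X) * yEmb (foldY ε (-1)))) +
      X * (X * (C X * (C (C X) * yEmb (foldY ε (-1))))) by ring]
  have hrec (a b : ℕ) := foldGF_eq ε (a := a) (b := b) (by omega)
  have hneg (a : ℕ) := foldGF_neg_right ε (a := a) (by omega)
  have hneg' := foldGF_neg_right ε (a := -1) (by omega)
  ext1 n
  ext1 m
  have hmap (F : ℚ⟦X⟧⟦X⟧) : constantCoeff (yEmb F) = C (constantCoeff F) := by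
    rw [← coeff_zero_eq_constantCoeff_apply, coeff_map, coeff_zero_eq_constantCoeff_apply]
  rcases n with _ | _ | n <;> rcases m with _ | _ | m
  · simp [foldXY, foldX, foldY, hmap]
  · simp [foldXY, foldX, foldY, hmap]
  · simp [foldXY, foldX, foldY, hmap]
  · simp [foldXY, foldX, foldY]
  · have := hrec 0 0
    simp [foldXY, foldX, foldY, coeff_C, hneg'] at this ⊢
    linear_combination this
  · have := hrec (m + 1) 0
    have h' := hneg m
    simp [foldXY, foldX, foldY, coeff_X] at this h' ⊢
    rw [if_neg (by omega)] at this
    rw [h'] at this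
    linear_combination this
  · simp [foldXY, foldX, foldY, coeff_X]
  · have := hrec 0 (n + 1)
    simp [foldXY, foldX, foldY, coeff_C, coeff_X] at this ⊢
    rw [if_neg (by omega)] at this
    linear_combination this
  · have := hrec (m + 1) (n + 1)
    simp [foldXY, foldX, foldY, coeff_X] at this ⊢
    rw [if_neg (by omega)] at this
    linear_combination this

end KernelEquation

section Invariants

theorem yEmb_C (a : ℚ⟦X⟧) : yEmb (C a) = C (C a) := map_C _ _

theorem yEmb_X : yEmb X = X := map_X _

theorem X_mul_mk_add_C {R : Type*} [CommRing R] (f : ℕ → R) :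
    (PowerSeries.mk f : R⟦X⟧) = C (f 0) + X * PowerSeries.mk fun n => f (n + 1) := by
  ext (_ | n) <;> simp

theorem C_X_ne_zero : (C X : ℚ⟦X⟧⟦X⟧) ≠ 0 := by
  rw [Ne, map_eq_zero_iff _ C_injective]
  exact X_ne_zero

/-- The inverse of `1 + y`. -/
noncomputable def invOneAdd : ℚ⟦X⟧⟦X⟧ := invOfUnit (1 + X) 1

theorem one_add_mul_invOneAdd : (1 + X) * invOneAdd = 1 := mul_invOfUnit _ _ (by simp)

/-- The series `t Q(0, 0)` where `Q = foldXY (-1)`. -/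
noncomputable def antiConst : ℚ⟦X⟧ := X * foldGF (-1) 0 0

/-- The series `t (Q(x, 0) - Q(0, 0)) / x` where `Q = foldXY (-1)`. -/
noncomputable def antiX : ℚ⟦X⟧⟦X⟧ := PowerSeries.mk fun n => X * foldGF (-1) (n + 1) 0

/-- The series `y / (1 + y) - t² (1 + y) Q(0, y)` where `Q = foldXY (-1)`. -/
noncomputable def antiY : ℚ⟦X⟧⟦X⟧ := X * invOneAdd - C (X ^ 2) * (1 + X) * foldY (-1) 0

theorem C_X_mul_foldX_neg_one : C X * foldX (-1) = C antiConst + X * antiX := by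
  rw [foldX, X_mul_mk_add_C, mul_add, ← map_mul, mul_left_comm]
  simp only [Nat.cast_zero, Nat.cast_add, Nat.cast_one]
  congr 2
  ext1 n
  simp [antiX]

theorem foldY_neg_one_neg_one : foldY (-1) (-1) = 0 := by
  ext1 n
  simp [foldY, foldGF]

theorem exists_antiY_add : ∃ g : ℚ⟦X⟧⟦X⟧, constantCoeff (constantCoeff g) = 1 ∧
    antiY + C (X * antiConst) = X * g := by
  obtain ⟨m, hm⟩ : ∃ m, foldY (-1) 0 = C (foldGF (-1) 0 0) + X * m :=
    ⟨_, by rw [foldY, X_mul_mk_add_C, Nat.cast_zero]⟩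
  refine ⟨invOneAdd - C (X ^ 2) * ((1 + X) * m + C (foldGF (-1) 0 0)), ?_, ?_⟩
  · simp [invOneAdd]
  · rw [antiY, hm, antiConst]
    simp only [map_mul, map_pow]
    ring

/-- Multiplying the kernel equation by `t x` decouples the variables. -/
theorem kernelPoly_mul_anti :
    kernelPoly * (yEmb invOneAdd + C (C X) * C X * foldXY (-1)) =
      C X * yEmb antiY - C (C X) * C (1 + X ^ 2 * antiX) := by
  have h := kernelPoly_mul_foldXY (-1)
  have h1 := congrArg (C : ℚ⟦X⟧⟦X⟧ →+* _) C_X_mul_foldX_neg_one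
  have h2 := congrArg yEmb one_add_mul_invOneAdd
  rw [foldY_neg_one_neg_one] at h
  simp only [map_add, map_mul, map_sub, map_one, map_pow, yEmb_C, yEmb_X, antiY, antiConst,
    map_zero] at *
  rw [mul_add, show kernelPoly * (C (C X) * C X * foldXY (-1)) =
    C (C X) * C X * (kernelPoly * foldXY (-1)) by ring, h, kernelPoly]
  linear_combination (-C (C X) * C X) * h1 - C (C X) * (1 + C X ^ 2 * X) * h2

theorem anti_cubic : ∃ e : ℚ⟦X⟧,
    (1 - C X * X + 2 * C X * (PowerSeries.mk fun n => coeff (n + 1) antiX) + C X * X * antiX ^ 2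
      - antiX) * (1 + X ^ 2 * antiX + C antiConst * X) = C e ∧
    (C X ^ 2 * (X - 1) ^ 2 + X ^ 2 * invOneAdd ^ 2 + X * (antiY ^ 2 - antiY
      - C X ^ 2 * (2 * C (constantCoeff antiX) - 2))) * (antiY + C X * C antiConst)
        = C X ^ 2 * C e * X := by
  obtain ⟨g, -, hg⟩ := exists_antiY_add
  obtain ⟨s, hs⟩ : ∃ s, s = PowerSeries.mk fun n => coeff (n + 1) antiX := ⟨_, rfl⟩
  have hρ : antiX = C (constantCoeff antiX) + X * s := by
    rw [hs, add_comm]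
    exact eq_X_mul_shift_add_const antiX
  rw [← hs]
  have h0 := kernelPoly_mul_anti
  set G := yEmb invOneAdd + C (C X) * C X * foldXY (-1)
  obtain ⟨m, hm⟩ : ∃ m, m = (X - 1) ^ 2 - 2 * X ^ 2 * foldY (-1) 0 + X * (C X * (1 + X) *
    foldY (-1) 0) ^ 2 + X * (1 + X) * foldY (-1) 0 - X * (2 * C (constantCoeff antiX) - 2) :=
    ⟨_, rfl⟩
  have hw := one_add_mul_invOneAdd
  have hm' : C X ^ 2 * (X - 1) ^ 2 + X ^ 2 * invOneAdd ^ 2 + X * (antiY ^ 2 - antiY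
      - C X ^ 2 * (2 * C (constantCoeff antiX) - 2)) = C X ^ 2 * m := by
    rw [hm, antiY, map_pow]
    linear_combination (X ^ 2 * invOneAdd - 2 * X ^ 2 * C X ^ 2 * foldY (-1) 0) * hw
  have hker := (show kernelPoly = C X * X - C (C X) * (1 + X) * (1 + C X ^ 2 * X) from rfl)
  have h1 := congrArg yEmb hw
  have h2 := congrArg yEmb hm'
  have h3 := congrArg yEmb hg
  have h4 := congrArg (C : ℚ⟦X⟧⟦X⟧ →+* _) hρ
  obtain ⟨n, hn⟩ : ∃ n, n = (1 - C X * X + 2 * C X * s + C X * X * antiX ^ 2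
      - antiX) := ⟨_, rfl⟩
  have h5 := congrArg (C : ℚ⟦X⟧⟦X⟧ →+* _) hn
  simp only [map_add, map_mul, map_sub, map_one, map_pow, yEmb_C, yEmb_X, map_ofNat] at *
  have hN : C X * (C X ^ 2 + 1) - C (C X) * (C X ^ 2 + 1) ^ 2 + C (C X) * (1 + C X ^ 2 * C antiX) ^ 2
      - C X * (1 + C X ^ 2 * C antiX) - C (C X) * (2 * C (C (constantCoeff antiX)) - 2) * C X ^ 2 =
      C X ^ 3 * C n := by
    linear_combination (2 * C (C X) * C X ^ 2) * h4 - C X ^ 3 * h5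
  obtain ⟨H, hH⟩ : ∃ H, H = C (C X) * (C X ^ 2 + 1) - yEmb invOneAdd * (C X * X * yEmb invOneAdd +
      C (C X) * (1 + C X ^ 2 * X)) - X * G * (C (C X) * (1 + C X ^ 2 * C antiX) +
      C X * yEmb antiY) + C X * X * G := ⟨_, rfl⟩
  have hM : C (C X) * X * (C X ^ 3 * C n) - C X ^ 2 * (C (C X) ^ 2 * yEmb m) = kernelPoly * H := by
    rw [hH]
    linear_combination (-(C (C X) * X)) * hN + C X ^ 2 * h2
      + (X * (C (C X) * (1 + C X ^ 2 * C antiX) + C X * yEmb antiY) - C X * X) * h0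
      - (C (C X) * (C X ^ 2 + 1) - yEmb invOneAdd * (C X * X * yEmb invOneAdd +
        C (C X) * (1 + C X ^ 2 * X))) * hker
      - (C X * X * yEmb invOneAdd + C (C X) * (1 + C X ^ 2 * X)) * C (C X) * (1 + C X ^ 2 * X) * h1
  have hdvd : kernelPoly ∣ C (C X ^ 2 * (n * (1 + X ^ 2 * antiX + C antiConst * X)))
      - yEmb (C X ^ 2 * m * g) := by
    refine dvd_of_pow_mul_eq_kernelPoly_mul 3 1 (H := H * (C (C X) *
      (1 + C X ^ 2 * C antiX + C (C antiConst) * C X)) - C X ^ 2 * C (C X) ^ 2 * yEmb m * G) ?_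
    simp only [map_add, map_mul, map_one, map_pow, yEmb_C]
    linear_combination (C (C X) * (1 + C X ^ 2 * C antiX + C (C antiConst) * C X)) * hM
      + C X ^ 2 * C (C X) ^ 2 * yEmb m * h0 + C X ^ 3 * C (C X) ^ 2 * yEmb m * h3
  obtain ⟨hf, hg'⟩ := eq_C_of_kernelPoly_dvd hdvd
  rw [map_mul, map_pow, constantCoeff_C, map_mul, map_pow] at hf hg'
  refine ⟨constantCoeff (n * (1 + X ^ 2 * antiX + C antiConst * X)), ?_, ?_⟩
  · exact mul_left_cancel₀ (pow_ne_zero 2 C_X_ne_zero) (by rw [← hn, hf])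
  · rw [hm']
    linear_combination C X ^ 2 * m * hg + X * hg'

end Invariants

section SymmetricInvariants

/-- The series `1 + t (1 + y) D(y)`, where `D` collects the walks ending on the diagonal. -/
noncomputable def diagY : ℚ⟦X⟧⟦X⟧ :=
  1 + C X * (1 + X) * PowerSeries.mk fun n : ℕ => coneGF n n

/-- The series `1 - t x L(x, 0)` where `L = foldXY 1`. -/
noncomputable def symX : ℚ⟦X⟧⟦X⟧ := 1 - C X * X * foldX 1

theorem foldY_one_neg_one : foldY 1 (-1) = 2 * PowerSeries.mk fun n : ℕ => coneGF n n := by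
  rw [two_mul]
  ext1 n
  simp [foldY, foldGF]

theorem C_X_mul_foldY_one_zero : C X * (1 + X) * foldY 1 0 =
    X * (PowerSeries.mk fun n : ℕ => coneGF n n) + C (X * foldGF 1 0 0) := by
  rw [show C X * (1 + X) * foldY 1 0 = C X * foldY 1 0 + X * (C X * foldY 1 0) by ring]
  ext1 n
  rcases n with _ | n
  · simp [foldY]
  · have := coneGF_eq (i := n) (j := n) (by omega)
    rw [if_neg (by omega)] at this
    simp [foldY, foldGF]
    rw [this]
    ring

/-- Adding the diagonal to `x` times the symmetric series decouples the variables. -/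
theorem kernelPoly_mul_sym :
    kernelPoly * (C X * foldXY 1 + yEmb (PowerSeries.mk fun n : ℕ => coneGF n n)) =
      C symX - (1 - C X ^ 2 * X) * yEmb diagY := by
  have h := kernelPoly_mul_foldXY 1
  have h1 := congrArg yEmb C_X_mul_foldY_one_zero
  rw [foldY_one_neg_one] at h
  simp only [map_add, map_mul, map_sub, map_one, yEmb_C, yEmb_X, diagY, symX,
    map_ofNat] at *
  rw [mul_add, show kernelPoly * (C X * foldXY 1) = C X * (kernelPoly * foldXY 1) by ring, h,
    kernelPoly]
  linear_combination (-C X) * h1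

theorem sym_quadratic : ∃ l : ℚ⟦X⟧,
    symX ^ 2 = (1 + X ^ 2 * antiX) ^ 2 - 2 * C (X * foldGF 1 0 0) * X * (1 + X ^ 2 * antiX)
      + C l * X ^ 2 ∧
    (X ^ 2 * invOneAdd ^ 2 - 4 * C X ^ 2 * X) * diagY ^ 2 =
      antiY ^ 2 - 2 * C X * C (X * foldGF 1 0 0) * antiY + C X ^ 2 * C l := by
  have h0 := kernelPoly_mul_anti
  set G := yEmb invOneAdd + C (C X) * C X * foldXY (-1)
  have h1 := kernelPoly_mul_sym
  set K := C X * foldXY 1 + yEmb (PowerSeries.mk fun n : ℕ => coneGF n n)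
  obtain ⟨m, hm⟩ : ∃ m, foldX 1 = C (foldGF 1 0 0) + X * m :=
    ⟨_, by rw [foldX, X_mul_mk_add_C, Nat.cast_zero]⟩
  obtain ⟨b, hb⟩ : ∃ b, b = X * foldGF 1 0 0 := ⟨_, rfl⟩
  rw [← hb]
  obtain ⟨f, hf⟩ : ∃ f, f = C b ^ 2 - 2 * C X * m * (1 - C b * X) + C X ^ 2 * X ^ 2 * m ^ 2
    - 2 * antiX - X ^ 2 * antiX ^ 2 + 2 * C b * X * antiX := ⟨_, rfl⟩
  have hf' : symX ^ 2 - (1 + X ^ 2 * antiX) ^ 2 + 2 * C b * X * (1 + X ^ 2 * antiX) =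
      X ^ 2 * f := by
    rw [symX, hm, hf, hb, map_mul]
    ring
  obtain ⟨g, hg⟩ : ∃ g, g = (X ^ 2 * invOneAdd ^ 2 - 4 * C X ^ 2 * X) * diagY ^ 2 -
      (antiY ^ 2 - 2 * C X * C b * antiY) := ⟨_, rfl⟩
  have hdvd : kernelPoly ∣ C (C X ^ 2 * f) - yEmb g := by
    have hker := (show kernelPoly = C X * X - C (C X) * (1 + X) * (1 + C X ^ 2 * X) from rfl)
    have h2 := congrArg yEmb one_add_mul_invOneAdd
    have h3 := congrArg (C : ℚ⟦X⟧⟦X⟧ →+* _) hf'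
    have h4 := congrArg yEmb hg
    refine dvd_of_pow_mul_eq_kernelPoly_mul 2 0 (H :=
      C (C X) ^ 2 * K * (C symX + (1 - C X ^ 2 * X) * yEmb diagY)
      - yEmb invOneAdd * (C X * X * yEmb invOneAdd + C (C X) * (1 + C X ^ 2 * X)) * yEmb diagY ^ 2
      + G * (C X * yEmb antiY + C (C X) * C (1 + X ^ 2 * antiX)) - 2 * C (C X) * C (C b) * C X * G)
      ?_
    simp only [map_add, map_mul, map_sub, map_one, map_pow, yEmb_C, yEmb_X, map_ofNat] at *
    linear_combination (-C (C X) ^ 2) * h3 - C X ^ 2 * h4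
      - C (C X) ^ 2 * (C symX + (1 - C X ^ 2 * X) * yEmb diagY) * h1
      - (C X * yEmb antiY + C (C X) * (1 + C X ^ 2 * C antiX) - 2 * C (C X) * C (C b) * C X) * h0
      + yEmb invOneAdd * (C X * X * yEmb invOneAdd + C (C X) * (1 + C X ^ 2 * X)) *
        yEmb diagY ^ 2 * hker
      - C (C X) * (1 + C X ^ 2 * X) * (C X * X * yEmb invOneAdd + C (C X) * (1 + C X ^ 2 * X)) *
        yEmb diagY ^ 2 * h2
  obtain ⟨h, h'⟩ := eq_C_of_kernelPoly_dvd hdvd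
  rw [map_mul, map_pow, constantCoeff_C, map_mul, map_pow] at h h'
  refine ⟨constantCoeff f, ?_, ?_⟩
  · linear_combination hf' + X ^ 2 * mul_left_cancel₀ (pow_ne_zero 2 C_X_ne_zero) h
  · linear_combination h' - hg

end SymmetricInvariants

section CriticalPoints

theorem rescale_X_injective : Function.Injective (rescale (X : ℚ⟦X⟧)) := by
  intro f g h
  ext1 n
  have := congrArg (coeff n) h
  rw [coeff_rescale, coeff_rescale] at this
  exact mul_left_cancel₀ (pow_ne_zero n X_ne_zero) this

theorem exists_rescale_antiX : ∃ u : ℚ⟦X⟧⟦X⟧, rescale X u = 1 + X ^ 2 * antiX ∧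
    constantCoeff u = 1 := by
  have (n : ℕ) : ∃ g : ℚ⟦X⟧, coeff n (1 + X ^ 2 * antiX) = X ^ n * g := by
    rcases n with _ | _ | n
    · exact ⟨1, by simp⟩
    · exact ⟨0, by simp [coeff_X_pow_mul', coeff_one]⟩
    · obtain ⟨g, hg⟩ := X_pow_dvd_foldGF (-1) (n + 1)
      refine ⟨g, ?_⟩
      rw [map_add, coeff_X_pow_mul', if_pos (by omega), antiX, coeff_mk, coeff_one, if_neg (by omega), zero_add]
      push_cast at hg
      rw [show n + 1 + 1 - 2 = n by omega, hg, pow_succ' X (n + 1), mul_assoc]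
  choose g hg using this
  have hu : rescale X (PowerSeries.mk g) = 1 + X ^ 2 * antiX := by
    ext1 n
    rw [coeff_rescale, coeff_mk, hg]
  refine ⟨_, hu, ?_⟩
  simpa using (hg 0).symm

theorem rescale_C {R : Type*} [CommRing R] (c a : R) : rescale c (C a) = C a := by
  ext1 n
  rw [coeff_rescale, coeff_C]
  split_ifs with h <;> simp [h]

theorem rescale_X_X : rescale X X = (C X * X : ℚ⟦X⟧⟦X⟧) := rescale_X _

/-- At a critical point of the kernel, the derivative of the cubic vanishes. -/
theorem anti_critical {u : ℚ⟦X⟧⟦X⟧} (hu : rescale X u = 1 + X ^ 2 * antiX)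
    (hu1 : constantCoeff u = 1) {e : ℚ⟦X⟧}
    (he : (1 - C X * X + 2 * C X * (PowerSeries.mk fun n => coeff (n + 1) antiX)
      + C X * X * antiX ^ 2 - antiX) * (1 + X ^ 2 * antiX + C antiConst * X) = C e)
    {c v w : ℚ⟦X⟧} (hc : c ≠ 0) (hcrit : (c ^ 2 - 1) * (c - 2 * X * (c ^ 2 + 1)) = 0)
    (hv : c * v = X * evalMulX c u) (hw : c ^ 2 * w = X * (c ^ 3 + c) - X ^ 2 * (c ^ 2 + 1) ^ 2) :
    (2 * v - 1) * (v + X * antiConst)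
      + (w + v ^ 2 - v - X ^ 2 * (2 * constantCoeff antiX - 2)) = 0 ∧
    (w + v ^ 2 - v - X ^ 2 * (2 * constantCoeff antiX - 2)) * (v + X * antiConst) = X ^ 2 * e := by
  obtain ⟨a, ha⟩ : ∃ a, a = 2 * constantCoeff antiX - 2 := ⟨_, rfl⟩
  obtain ⟨s, hs⟩ : ∃ s, s = PowerSeries.mk fun n => coeff (n + 1) antiX := ⟨_, rfl⟩
  have hρ : antiX = C (constantCoeff antiX) + X * s := by
    rw [hs, add_comm]
    exact eq_X_mul_shift_add_const antiX
  rw [← hs] at he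
  rw [← ha]
  have hP : (X ^ 3 + C X ^ 2 * X - (X ^ 2 + C X ^ 2) ^ 2 + C X ^ 4 * u ^ 2 - C X ^ 2 * X * u
      - C X ^ 2 * C a * X ^ 2) * (C X * u + C antiConst * X) = C X * C e * X ^ 3 := by
    refine rescale_X_injective ?_
    have ha' := congrArg (C : ℚ⟦X⟧ →+* _) ha
    simp only [map_add, map_sub, map_mul, map_pow, rescale_C, rescale_X_X, hu, map_ofNat] at ha' ⊢
    linear_combination (C X ^ 4 * X ^ 3) * he + (2 * C X ^ 5 * X ^ 2 *
      (1 + X ^ 2 * antiX + C antiConst * X)) * hρ - (C X ^ 5 * X ^ 2 *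
      (1 + X ^ 2 * antiX + C antiConst * X)) * ha'
  have hd : (X * d⁄dX ℚ⟦X⟧ u - u) * ((2 * C X ^ 4 * u - C X ^ 2 * X) * (C X * u + C antiConst * X)
      + C X * (X ^ 3 + C X ^ 2 * X - (X ^ 2 + C X ^ 2) ^ 2 + C X ^ 4 * u ^ 2 - C X ^ 2 * X * u
      - C X ^ 2 * C a * X ^ 2)) + (C X * u + C antiConst * X) *
      ((X ^ 2 - C X ^ 2) * (X - 2 * (X ^ 2 + C X ^ 2))) = 0 := by
    have := congrArg (d⁄dX ℚ⟦X⟧) hP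
    simp only [Derivation.leibniz, Derivation.leibniz_pow, map_add, map_sub, derivative_X,
      derivative_C, smul_eq_mul, ← map_pow] at this
    simp only [map_pow, nsmul_eq_mul, Nat.cast_ofNat] at this
    linear_combination X * this - 3 * hP
  have h1 := congrArg (evalMulX c) hP
  have h2 := congrArg (evalMulX c) hd
  have hδ : evalMulX c (X * d⁄dX ℚ⟦X⟧ u - u) ≠ 0 := by
    intro h
    have := congrArg constantCoeff h
    rw [constantCoeff_evalMulX] at this
    simp [hu1] at this
  simp only [map_add, map_sub, map_mul, map_pow, evalMulX_C, evalMulX_X, map_ofNat, map_zero]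
    at h1 h2 hδ
  set z := evalMulX c u
  set d := evalMulX c (d⁄dX ℚ⟦X⟧ u)
  have hN : (c * X) ^ 3 + X ^ 2 * (c * X) - ((c * X) ^ 2 + X ^ 2) ^ 2 + X ^ 4 * z ^ 2
      - X ^ 2 * (c * X) * z - X ^ 2 * a * (c * X) ^ 2 =
      X ^ 2 * c ^ 2 * (w + v ^ 2 - v - X ^ 2 * a) := by
    linear_combination (-X ^ 2) * hw - X ^ 2 * (X * z + c * v) * hv + X ^ 2 * c * hv
  have hL : X * z + antiConst * (c * X) = c * (v + X * antiConst) := by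
    linear_combination -hv
  rw [hN, hL] at h1 h2
  have h3 : X ^ 3 * c ^ 2 ≠ 0 := mul_ne_zero (pow_ne_zero _ X_ne_zero) (pow_ne_zero _ hc)
  have h4 : X ^ 2 * c ^ 3 ≠ 0 := mul_ne_zero (pow_ne_zero _ X_ne_zero) (pow_ne_zero _ hc)
  refine ⟨mul_left_cancel₀ h3 (mul_left_cancel₀ hδ ?_), mul_left_cancel₀ h4 ?_⟩
  · linear_combination h2 - X ^ 3 * c * (v + X * antiConst) * hcrit
      + 2 * (c * X * d - z) * X ^ 3 * c * (v + X * antiConst) * hv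
  · linear_combination h1

end CriticalPoints

section Algebraicity

/-- The subring of power series that are algebraic over the polynomials. -/
noncomputable def algSeries : Subring ℚ⟦X⟧ :=
  (Subalgebra.algebraicClosure (Polynomial ℚ) ℚ⟦X⟧).toSubring

theorem mem_algSeries {f : ℚ⟦X⟧} : f ∈ algSeries ↔ IsAlgebraic (Polynomial ℚ) f := Iff.rfl

theorem mem_algSeries_of_mul (f g : ℚ⟦X⟧) (hf : f ∈ algSeries) (hf0 : f ≠ 0)
    (h : f * g ∈ algSeries) : g ∈ algSeries :=
  IsAlgebraic.of_mul (mem_nonZeroDivisors_of_ne_zero hf0) hf h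

theorem coe_mem_algSeries (p : Polynomial ℚ) : (p : ℚ⟦X⟧) ∈ algSeries := by
  have := isAlgebraic_algebraMap (A := ℚ⟦X⟧) p
  rwa [PowerSeries.algebraMap_apply', Algebra.algebraMap_self, PowerSeries.map_id] at this

theorem X_mem_algSeries : X ∈ algSeries := by
  have := coe_mem_algSeries Polynomial.X
  rwa [Polynomial.coe_X] at this

theorem mem_algSeries_of_conic {p h : ℚ⟦X⟧} (hp : p ≠ 0)
    (h1 : 16 * (4 * X - 1) ^ 2 * p ^ 2 = -(h * (4 * p + h) ^ 3))
    (h2 : (4 * X + 1) ^ 2 * p = -(p + h) ^ 3) : p ∈ algSeries ∧ h ∈ algSeries := by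
  let φ := algebraMap ℚ⟦X⟧ (FractionRing ℚ⟦X⟧)
  have hφ : Function.Injective φ := IsFractionRing.injective _ _
  have hX : algebraMap (Polynomial ℚ) (FractionRing ℚ⟦X⟧) Polynomial.X = φ X := by
    rw [IsScalarTower.algebraMap_apply (Polynomial ℚ) ℚ⟦X⟧ (FractionRing ℚ⟦X⟧),
      PowerSeries.algebraMap_apply']
    simp [φ]
  have hp' : φ p ≠ 0 := (map_ne_zero_iff _ hφ).2 hp
  obtain ⟨ρ, hρ⟩ : ∃ ρ, φ h = ρ * φ p := ⟨φ h / φ p, by field_simp⟩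
  have h1' := congrArg φ h1
  have h2' := congrArg φ h2
  simp only [map_mul, map_add, map_sub, map_neg, map_pow, map_one, map_ofNat, hρ] at h1' h2'
  have e1 : 16 * (4 * φ X - 1) ^ 2 = -(φ p ^ 2 * ρ * (4 + ρ) ^ 3) :=
    mul_right_cancel₀ (pow_ne_zero 2 hp') (by linear_combination h1')
  have e2 : (4 * φ X + 1) ^ 2 = -(φ p ^ 2 * (1 + ρ) ^ 3) :=
    mul_right_cancel₀ hp' (by linear_combination h2')
  have hρalg : IsAlgebraic (Polynomial ℚ) ρ := by
    refine ⟨Polynomial.C (16 * (4 * Polynomial.X - 1) ^ 2) * (1 + Polynomial.X) ^ 3 -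
      Polynomial.C ((4 * Polynomial.X + 1) ^ 2) * Polynomial.X * (4 + Polynomial.X) ^ 3, ?_, ?_⟩
    · intro h0
      have := congrArg (fun P => Polynomial.eval 0 (Polynomial.eval 0 P)) h0
      simp at this
    · simp only [map_sub, map_mul, map_add, map_pow, Polynomial.aeval_C, Polynomial.aeval_X,
        map_ofNat, map_one, hX]
      rw [e1, e2]
      ring
  have hρ1 : 1 + ρ ≠ 0 := by
    intro h0
    rw [h0] at e2
    have : (4 * X + 1 : ℚ⟦X⟧) ^ 2 = 0 := hφ (by
      simp only [map_mul, map_add, map_pow, map_one, map_ofNat, map_zero]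
      simpa using e2)
    have := congrArg constantCoeff this
    simp at this
  have hpalg : IsAlgebraic (Polynomial ℚ) (φ p) := by
    refine IsAlgebraic.of_pow two_pos (IsAlgebraic.of_mul
      (mem_nonZeroDivisors_of_ne_zero (pow_ne_zero 3 hρ1))
      ((isAlgebraic_one.add hρalg).pow 3) ?_)
    rw [show (1 + ρ) ^ 3 * φ p ^ 2 = -(4 * φ X + 1) ^ 2 by linear_combination e2]
    have := (isAlgebraic_algebraMap (A := FractionRing ℚ⟦X⟧)
      ((4 * Polynomial.X + 1 : Polynomial ℚ) ^ 2)).neg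
    simpa only [map_mul, map_add, map_pow, map_one, map_ofNat, hX] using this
  have hhalg : IsAlgebraic (Polynomial ℚ) (φ h) := by
    rw [hρ]
    exact hρalg.mul hpalg
  exact ⟨(isAlgebraic_algebraMap_iff hφ).1 hpalg, (isAlgebraic_algebraMap_iff hφ).1 hhalg⟩

/-- Three distinct double points of the cubics `p (p + γ)² = ε`, `3 p² + 2 γ p = α + ω` with
known `ω` determine all the parameters up to algebraicity. -/
theorem mem_algSeries_of_double_points {p₁ p₂ p₃ γ α ε : ℚ⟦X⟧} (h₁₂ : p₁ ≠ p₂) (h₁₃ : p₁ ≠ p₃)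
    (h₂₃ : p₂ ≠ p₃) (e₁ : p₁ * (p₁ + γ) ^ 2 = ε) (e₂ : p₂ * (p₂ + γ) ^ 2 = ε)
    (e₃ : p₃ * (p₃ + γ) ^ 2 = ε) (f₁ : 3 * p₁ ^ 2 + 2 * γ * p₁ = α + (4 * X - 1) ^ 2)
    (f₂ : 3 * p₂ ^ 2 + 2 * γ * p₂ = α + (4 * X + 1) ^ 2) (f₃ : 3 * p₃ ^ 2 + 2 * γ * p₃ = α) :
    γ ∈ algSeries ∧ α ∈ algSeries ∧ ε ∈ algSeries := by
  have g₁₂ : p₁ ^ 2 + p₁ * p₂ + p₂ ^ 2 + 2 * γ * (p₁ + p₂) + γ ^ 2 = 0 :=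
    mul_left_cancel₀ (sub_ne_zero.2 h₁₂) (by linear_combination e₁ - e₂)
  have g₁₃ : p₁ ^ 2 + p₁ * p₃ + p₃ ^ 2 + 2 * γ * (p₁ + p₃) + γ ^ 2 = 0 :=
    mul_left_cancel₀ (sub_ne_zero.2 h₁₃) (by linear_combination e₁ - e₃)
  have hγ : p₁ + p₂ + p₃ + 2 * γ = 0 :=
    mul_left_cancel₀ (sub_ne_zero.2 h₂₃) (by linear_combination g₁₂ - g₁₃)
  obtain ⟨h, hh⟩ : ∃ h, h = p₃ - p₁ - p₂ := ⟨_, rfl⟩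
  have hsq : h ^ 2 = 4 * (p₁ * p₂) := by
    rw [hh]
    linear_combination 4 * g₁₂ + (p₃ - 3 * p₁ - 3 * p₂ - 2 * γ) * hγ
  have hω₁ : (p₁ - p₃) * (2 * p₁ + 2 * p₃ - p₂) = (4 * X - 1) ^ 2 := by
    linear_combination f₁ - f₃ - (p₁ - p₃) * hγ
  have hω₂ : (p₂ - p₃) * (2 * p₂ + 2 * p₃ - p₁) = (4 * X + 1) ^ 2 := by
    linear_combination f₂ - f₃ - (p₂ - p₃) * hγ
  have hp₃ : p₃ = h + p₁ + p₂ := by rw [hh]; ring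
  have hp₁ : p₁ ≠ 0 := by
    rintro rfl
    rw [zero_mul, mul_zero, sq_eq_zero_iff] at hsq
    rw [hp₃, hsq] at hω₂
    have := congrArg constantCoeff hω₂
    simp at this
  obtain ⟨hp, hhm⟩ := mem_algSeries_of_conic (p := p₁) (h := h) hp₁
    (by
      rw [← hω₁, hp₃]
      linear_combination (4 * p₁ * (4 * p₁ + 2 * h + p₂) + h * (4 * p₁ + h)) * hsq)
    (by
      rw [← hω₂, hp₃]
      linear_combination (h + p₁) * hsq)
  have : CharZero ℚ⟦X⟧ := algebraRat.charZero _
  have hm (n : ℕ) (f : ℚ⟦X⟧) (hf : f ∈ algSeries) : (n : ℚ⟦X⟧) * f ∈ algSeries :=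
    mul_mem (natCast_mem _ n) hf
  have hp₂m : p₂ ∈ algSeries := by
    refine mem_algSeries_of_mul (4 * p₁) _ (hm 4 _ hp) (mul_ne_zero (by norm_num) hp₁) ?_
    rw [mul_assoc, ← hsq]
    exact pow_mem hhm 2
  have hp₃m : p₃ ∈ algSeries := hp₃ ▸ add_mem (add_mem hhm hp) hp₂m
  have hγm : γ ∈ algSeries := by
    refine mem_algSeries_of_mul 2 _ (natCast_mem _ 2) two_ne_zero ?_
    rw [show 2 * γ = -(p₁ + p₂ + p₃) by linear_combination hγ]
    exact neg_mem (add_mem (add_mem hp hp₂m) hp₃m)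
  refine ⟨hγm, ?_, ?_⟩
  · rw [← f₃]
    exact add_mem (hm 3 _ (pow_mem hp₃m 2)) (mul_mem (hm 2 _ hγm) hp₃m)
  · rw [← e₁]
    exact mul_mem hp (pow_mem (add_mem hp hγm) 2)

end Algebraicity

section Parameters

theorem exists_catalan : ∃ g : ℚ⟦X⟧, constantCoeff g = 1 ∧ g = 1 + 4 * X ^ 2 * g ^ 2 := by
  have h := congrArg (PowerSeries.map (C.comp (Nat.castRingHom ℚ))) catalanSeries_sq_mul_X_add_one
  have h' := congrArg (evalMulX (4 * X)) h
  simp only [map_add, map_mul, map_pow, map_X, map_one, evalMulX_X] at h'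
  refine ⟨evalMulX (4 * X) (PowerSeries.map (C.comp (Nat.castRingHom ℚ)) catalanSeries), ?_,
    by linear_combination -h'⟩
  rw [constantCoeff_evalMulX, ← coeff_zero_eq_constantCoeff_apply (PowerSeries.map _ _), coeff_map]
  simp

theorem anti_params_mem {e : ℚ⟦X⟧}
    (he : (1 - C X * X + 2 * C X * (PowerSeries.mk fun n => coeff (n + 1) antiX)
      + C X * X * antiX ^ 2 - antiX) * (1 + X ^ 2 * antiX + C antiConst * X) = C e) :
    antiConst ∈ algSeries ∧ constantCoeff antiX ∈ algSeries ∧ e ∈ algSeries := by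
  obtain ⟨u, hu, hu1⟩ := exists_rescale_antiX
  obtain ⟨g, hg1, hg⟩ := exists_catalan
  have hinv : g * invOfUnit g 1 = 1 := mul_invOfUnit g 1 (by simp [hg1])
  have hhalf : C (1 / 2 : ℚ) * 2 = (1 : ℚ⟦X⟧) := by
    rw [← map_ofNat (C : ℚ →+* ℚ⟦X⟧) 2, ← map_mul]
    norm_num
  have h2 : constantCoeff (2 : ℚ⟦X⟧) = 2 := map_ofNat _ 2
  have hu' (c : ℚ⟦X⟧) : constantCoeff (evalMulX c u) = 1 := by
    rw [constantCoeff_evalMulX, hu1, map_one]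
  obtain ⟨a₁, b₁⟩ := anti_critical hu hu1 he (c := 1) (v := X * evalMulX 1 u)
    (w := 2 * X - 4 * X ^ 2) one_ne_zero (by ring) (by ring) (by ring)
  obtain ⟨a₂, b₂⟩ := anti_critical hu hu1 he (c := -1) (v := -(X * evalMulX (-1) u))
    (w := -2 * X - 4 * X ^ 2) (neg_ne_zero.2 one_ne_zero) (by ring) (by ring) (by ring)
  have : CharZero ℚ⟦X⟧ := algebraRat.charZero _
  have hc0 : 2 * X * g ≠ 0 := by
    refine mul_ne_zero (mul_ne_zero (by norm_num) X_ne_zero) ?_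
    rintro rfl
    simp at hg1
  have hD : X * ((2 * X * g) ^ 2 + 1) = C (1 / 2 : ℚ) * (2 * X * g) := by
    linear_combination (-(X * ((2 * X * g) ^ 2 + 1))) * hhalf - C (1 / 2 : ℚ) * 2 * X * hg
  obtain ⟨a₃, b₃⟩ := anti_critical hu hu1 he (c := 2 * X * g)
    (v := C (1 / 2 : ℚ) * evalMulX (2 * X * g) u * invOfUnit g 1) (w := C (1 / 2 : ℚ) ^ 2)
    hc0 (by linear_combination ((2 * X * g) ^ 2 - 1) * 2 * X * hg)
    (by linear_combination (X * C (1 / 2 : ℚ) * 2 * evalMulX (2 * X * g) u) * hinv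
          + (X * evalMulX (2 * X * g) u) * hhalf)
    (by linear_combination (2 * X * g) ^ 2 * C (1 / 2 : ℚ) * hhalf - (2 * X * g -
          X * ((2 * X * g) ^ 2 + 1) - C (1 / 2 : ℚ) * (2 * X * g)) * hD)
  set v₁ := X * evalMulX 1 u with hv₁
  set v₂ := -(X * evalMulX (-1) u) with hv₂
  set v₃ := C (1 / 2 : ℚ) * evalMulX (2 * X * g) u * invOfUnit g 1 with hv₃
  obtain ⟨a, ha⟩ : ∃ a, a = 2 * constantCoeff antiX - 2 := ⟨_, rfl⟩
  rw [← ha] at a₁ a₂ a₃ b₁ b₂ b₃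
  obtain ⟨m₁, m₂, m₃⟩ := mem_algSeries_of_double_points (p₁ := 2 * v₁ - 1) (p₂ := 2 * v₂ - 1)
    (p₃ := 2 * v₃ - 1) (γ := 2 * (X * antiConst) + 1) (α := 4 * X ^ 2 * a) (ε := -4 * X ^ 2 * e)
    (by
      intro h
      have h0 : evalMulX 1 u + evalMulX (-1) u = 0 :=
        mul_left_cancel₀ (mul_ne_zero two_ne_zero X_ne_zero) (by linear_combination h)
      have := congrArg constantCoeff h0
      rw [map_add, hu', hu'] at this
      norm_num at this)
    (by
      intro h
      have := congrArg constantCoeff h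
      norm_num [hv₁, hv₃, hu', h2] at this)
    (by
      intro h
      have := congrArg constantCoeff h
      norm_num [hv₂, hv₃, hu', h2] at this)
    (by linear_combination 4 * (v₁ + X * antiConst) * a₁ - 4 * b₁)
    (by linear_combination 4 * (v₂ + X * antiConst) * a₂ - 4 * b₂)
    (by linear_combination 4 * (v₃ + X * antiConst) * a₃ - 4 * b₃)
    (by linear_combination 4 * a₁) (by linear_combination 4 * a₂)
    (by linear_combination 4 * a₃ - (C (1 / 2 : ℚ) * 2 + 1) * hhalf)
  have h4X : 4 * X ^ 2 ∈ algSeries := mul_mem (natCast_mem _ 4) (pow_mem X_mem_algSeries 2)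
  have h4X0 : 4 * X ^ 2 ≠ (0 : ℚ⟦X⟧) := mul_ne_zero (by norm_num) (pow_ne_zero 2 X_ne_zero)
  refine ⟨?_, ?_, ?_⟩
  · refine mem_algSeries_of_mul (2 * X) _ (mul_mem (natCast_mem _ 2) X_mem_algSeries)
      (mul_ne_zero two_ne_zero X_ne_zero) ?_
    rw [show 2 * X * antiConst = 2 * (X * antiConst) + 1 - 1 by ring]
    exact sub_mem m₁ (one_mem _)
  · refine mem_algSeries_of_mul 2 _ (natCast_mem _ 2) two_ne_zero ?_
    rw [show 2 * constantCoeff antiX = a + (1 + 1) by rw [ha]; ring]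
    exact add_mem (mem_algSeries_of_mul _ _ h4X h4X0 m₂) (add_mem (one_mem _) (one_mem _))
  · refine mem_algSeries_of_mul _ _ h4X h4X0 ?_
    rw [show 4 * X ^ 2 * e = -(-4 * X ^ 2 * e) by ring]
    exact neg_mem m₃

end Parameters

section Coefficients

theorem mem_algSeries_of_cubic {a b c d x : ℚ⟦X⟧} (ha : a ∈ algSeries) (hb : b ∈ algSeries)
    (hc : c ∈ algSeries) (hd : d ∈ algSeries) (ha0 : a ≠ 0)
    (h : a * x ^ 3 + b * x ^ 2 + c * x + d = 0) : x ∈ algSeries := by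
  let T := Subalgebra.algebraicClosure (Polynomial ℚ) ℚ⟦X⟧
  have : IsAlgebraic T x := by
    refine ⟨(⟨⟨a, ha⟩, ⟨b, hb⟩, ⟨c, hc⟩, ⟨d, hd⟩⟩ : Cubic T).toPoly,
      Cubic.ne_zero_of_a_ne_zero fun h0 => ha0 (congrArg Subtype.val h0), ?_⟩
    simp only [Cubic.toPoly, map_add, map_mul, map_pow, Polynomial.aeval_C, Polynomial.aeval_X]
    exact h
  exact this.restrictScalars (Polynomial ℚ)

/-- The series all of whose coefficients are algebraic. -/
noncomputable def algCoeffs : Subring ℚ⟦X⟧⟦X⟧ := ⨅ k, coeffsIn algSeries k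

theorem mem_algCoeffs {f : ℚ⟦X⟧⟦X⟧} : f ∈ algCoeffs ↔ ∀ k, f ∈ coeffsIn algSeries k :=
  Subring.mem_iInf

theorem coeff_mem_of_mem_algCoeffs {f : ℚ⟦X⟧⟦X⟧} (h : f ∈ algCoeffs) (n : ℕ) :
    coeff n f ∈ algSeries :=
  mem_algCoeffs.1 h (n + 1) n n.lt_succ_self

theorem C_mem_algCoeffs {a : ℚ⟦X⟧} (h : a ∈ algSeries) : C a ∈ algCoeffs :=
  mem_algCoeffs.2 fun _ => C_mem_coeffsIn h

theorem X_mem_algCoeffs : X ∈ algCoeffs := mem_algCoeffs.2 fun _ => X_mem_coeffsIn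

theorem mem_algCoeffs_of_mul {f g : ℚ⟦X⟧⟦X⟧} (hf : f ∈ algCoeffs) (hf0 : constantCoeff f ≠ 0)
    (h : f * g ∈ algCoeffs) : g ∈ algCoeffs :=
  mem_algCoeffs.2 (mem_coeffsIn_of_mul mem_algSeries_of_mul (mem_algCoeffs.1 hf) hf0
    (mem_algCoeffs.1 h))

theorem mem_algCoeffs_of_X_mul {f : ℚ⟦X⟧⟦X⟧} (h : X * f ∈ algCoeffs) : f ∈ algCoeffs :=
  mem_algCoeffs.2 fun k => mem_coeffsIn_of_X_mul (mem_algCoeffs.1 h (k + 1))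

theorem mem_algCoeffs_of_sq {f : ℚ⟦X⟧⟦X⟧} (hf0 : constantCoeff (constantCoeff f) ≠ 0)
    (h : f ^ 2 ∈ algCoeffs) : f ∈ algCoeffs := by
  have : CharZero ℚ⟦X⟧ := algebraRat.charZero _
  have hc : constantCoeff f ∈ algSeries := by
    refine IsAlgebraic.of_pow (n := 2) two_pos ?_
    rw [← map_pow, ← coeff_zero_eq_constantCoeff_apply]
    exact coeff_mem_of_mem_algCoeffs h 0
  refine mem_algCoeffs.2 (mem_coeffsIn_of_sq mem_algSeries_of_mul hc ?_ (mem_algCoeffs.1 h))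
  refine mul_ne_zero two_ne_zero fun h0 => hf0 ?_
  rw [h0, map_zero]

theorem antiX_mem {e : ℚ⟦X⟧} (hb : antiConst ∈ algSeries)
    (hr : constantCoeff antiX ∈ algSeries) (hem : e ∈ algSeries)
    (he : (1 - C X * X + 2 * C X * (PowerSeries.mk fun n => coeff (n + 1) antiX)
      + C X * X * antiX ^ 2 - antiX) * (1 + X ^ 2 * antiX + C antiConst * X) = C e) :
    antiX ∈ algCoeffs := by
  have : CharZero ℚ⟦X⟧ := algebraRat.charZero _
  obtain ⟨s, hs⟩ : ∃ s, s = PowerSeries.mk fun n => coeff (n + 1) antiX := ⟨_, rfl⟩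
  have hρ : antiX = C (constantCoeff antiX) + X * s := by
    rw [hs, add_comm]
    exact eq_X_mul_shift_add_const antiX
  rw [← hs] at he
  have key (k : ℕ) : antiX ∈ coeffsIn algSeries (k + 1) := by
    induction k with
    | zero =>
      intro j hj
      rw [Nat.lt_one_iff.1 hj, coeff_zero_eq_constantCoeff_apply]
      exact hr
    | succ k ih =>
      have hsk : s ∈ coeffsIn algSeries k := by
        refine mem_coeffsIn_of_X_mul ?_
        rw [show X * s = antiX - C (constantCoeff antiX) by linear_combination -hρ]
        exact sub_mem ih (C_mem_coeffsIn hr)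
      have hX : (X : ℚ⟦X⟧⟦X⟧) ∈ coeffsIn algSeries (k + 1) := X_mem_coeffsIn
      have hbk : C antiConst ∈ coeffsIn algSeries (k + 1) := C_mem_coeffsIn hb
      have hek : C e ∈ coeffsIn algSeries (k + 1) := C_mem_coeffsIn hem
      have ht : C X ∈ coeffsIn algSeries (k + 1) := C_mem_coeffsIn X_mem_algSeries
      have hX' : X * ((C antiConst + X * antiX) * s) ∈ coeffsIn algSeries (k + 1) :=
        X_mul_mem_coeffsIn (mul_mem (coeffsIn_anti k.le_succ (add_mem hbk (mul_mem hX ih))) hsk)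
      have hs' : s ∈ coeffsIn algSeries (k + 1) := by
        refine mem_coeffsIn_of_C_mul mem_algSeries_of_mul (a := 2 * X)
          (mul_mem (natCast_mem _ 2) X_mem_algSeries) (mul_ne_zero two_ne_zero X_ne_zero) ?_
        rw [map_mul, map_ofNat, show 2 * C X * s = C e - (1 - C X * X + C X * X * antiX ^ 2 -
          antiX) * (1 + X ^ 2 * antiX + C antiConst * X) - (C X + C X) *
          (X * ((C antiConst + X * antiX) * s)) by linear_combination he]
        refine sub_mem (sub_mem hek (mul_mem (sub_mem (add_mem (sub_mem (one_mem _)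
          (mul_mem ht hX)) (mul_mem (mul_mem ht hX) (pow_mem ih 2))) ih) (add_mem (add_mem
          (one_mem _) (mul_mem (pow_mem hX 2) ih)) (mul_mem hbk hX)))) (mul_mem (add_mem ht ht) hX')
      rw [hρ]
      exact add_mem (C_mem_coeffsIn hr) (X_mul_mem_coeffsIn hs')
  exact mem_algCoeffs.2 fun k => coeffsIn_anti k.le_succ (key k)

theorem invOneAdd_mem : invOneAdd ∈ algCoeffs := by
  refine mem_algCoeffs_of_mul (f := 1 + X) (add_mem (one_mem _) X_mem_algCoeffs) (by simp) ?_
  rw [one_add_mul_invOneAdd]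
  exact one_mem _

theorem antiY_mem {e : ℚ⟦X⟧} (hb : antiConst ∈ algSeries)
    (hr : constantCoeff antiX ∈ algSeries) (hem : e ∈ algSeries)
    (he : (C X ^ 2 * (X - 1) ^ 2 + X ^ 2 * invOneAdd ^ 2 + X * (antiY ^ 2 - antiY
      - C X ^ 2 * (2 * C (constantCoeff antiX) - 2))) * (antiY + C X * C antiConst)
        = C X ^ 2 * C e * X) :
    antiY ∈ algCoeffs := by
  obtain ⟨g, -, hg⟩ := exists_antiY_add
  rw [map_mul] at hg
  rw [hg] at he
  have hb' : C X * C antiConst ∈ algCoeffs :=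
    mul_mem (C_mem_algCoeffs X_mem_algSeries) (C_mem_algCoeffs hb)
  have key (k : ℕ) : g ∈ coeffsIn algSeries k := by
    induction k with
    | zero => intro j hj; omega
    | succ k ih =>
      have hX : (X : ℚ⟦X⟧⟦X⟧) ∈ coeffsIn algSeries k := X_mem_coeffsIn
      have ht : C X ∈ coeffsIn algSeries k := C_mem_coeffsIn X_mem_algSeries
      have hrk : C (constantCoeff antiX) ∈ coeffsIn algSeries k := C_mem_coeffsIn hr
      have hw := mem_algCoeffs.1 invOneAdd_mem k
      have hj : antiY ∈ coeffsIn algSeries k := by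
        rw [show antiY = X * g - C X * C antiConst by linear_combination hg]
        exact sub_mem (mul_mem hX ih) (mem_algCoeffs.1 hb' k)
      refine mem_coeffsIn_of_C_mul mem_algSeries_of_mul (a := X ^ 2) (pow_mem X_mem_algSeries 2)
        (pow_ne_zero 2 X_ne_zero) ?_
      rw [map_pow, show C X ^ 2 * g = C (X ^ 2 * e) - X * ((C X ^ 2 * (X - (1 + 1)) +
        X * invOneAdd ^ 2 + antiY ^ 2 - antiY - C X ^ 2 * (C (constantCoeff antiX) +
          C (constantCoeff antiX) - (1 + 1))) * g) from mul_left_cancel₀ X_ne_zero (by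
            rw [map_mul, map_pow]; linear_combination he)]
      refine sub_mem (C_mem_coeffsIn (mul_mem (pow_mem X_mem_algSeries 2) hem))
        (X_mul_mem_coeffsIn (mul_mem ?_ ih))
      exact sub_mem (sub_mem (add_mem (add_mem (mul_mem (pow_mem ht 2) (sub_mem hX (add_mem
        (one_mem _) (one_mem _)))) (mul_mem hX (pow_mem hw 2))) (pow_mem hj 2)) hj)
        (mul_mem (pow_mem ht 2) (sub_mem (add_mem hrk hrk) (add_mem (one_mem _) (one_mem _))))
  rw [show antiY = X * g - C X * C antiConst by linear_combination hg]
  exact sub_mem (mul_mem X_mem_algCoeffs (mem_algCoeffs.2 key)) hb'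

end Coefficients

section Conclusion

theorem sym_params_mem {e l : ℚ⟦X⟧} (hb : antiConst ∈ algSeries)
    (hr : constantCoeff antiX ∈ algSeries) (hem : e ∈ algSeries)
    (he : (C X ^ 2 * (X - 1) ^ 2 + X ^ 2 * invOneAdd ^ 2 + X * (antiY ^ 2 - antiY
      - C X ^ 2 * (2 * C (constantCoeff antiX) - 2))) * (antiY + C X * C antiConst)
        = C X ^ 2 * C e * X)
    (hl : (X ^ 2 * invOneAdd ^ 2 - 4 * C X ^ 2 * X) * diagY ^ 2 =
      antiY ^ 2 - 2 * C X * C (X * foldGF 1 0 0) * antiY + C X ^ 2 * C l) :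
    X * foldGF 1 0 0 ∈ algSeries ∧ l ∈ algSeries := by
  have : CharZero ℚ⟦X⟧ := algebraRat.charZero _
  have h40 : (4 : ℚ⟦X⟧) ≠ 0 := by norm_num
  obtain ⟨g, hg0, hg⟩ := exists_catalan
  obtain ⟨f, hf0, hf⟩ := exists_antiY_add
  obtain ⟨m, hm⟩ : ∃ m, m = X * foldGF 1 0 0 := ⟨_, rfl⟩
  rw [← hm] at hl ⊢
  have h0 := congrArg constantCoeff hf
  simp only [map_add, map_mul, constantCoeff_X, constantCoeff_C, zero_mul] at h0
  have hl0 := congrArg constantCoeff hl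
  simp only [map_add, map_sub, map_mul, map_pow, map_ofNat, constantCoeff_X, constantCoeff_C,
    eq_neg_of_add_eq_zero_left h0] at hl0
  have hl1 : l = -(antiConst ^ 2 + (m + m) * antiConst) :=
    mul_left_cancel₀ (pow_ne_zero 2 X_ne_zero) (by linear_combination -hl0)
  have hw := congrArg (evalMulX (4 * X * g ^ 2)) one_add_mul_invOneAdd
  have hl2 := congrArg (evalMulX (4 * X * g ^ 2)) hl
  have he2 := congrArg (evalMulX (4 * X * g ^ 2)) he
  have hf2 := congrArg (evalMulX (4 * X * g ^ 2)) hf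
  have hf3 : evalMulX (4 * X * g ^ 2) f ≠ 0 := fun h => by
    have := constantCoeff_evalMulX (4 * X * g ^ 2) f
    rw [h, hf0, map_zero] at this
    exact zero_ne_one this
  simp only [map_add, map_sub, map_mul, map_pow, map_ofNat, map_one, evalMulX_X, evalMulX_C]
    at hw hl2 he2 hf2
  obtain ⟨y, hy⟩ : ∃ y, y = 4 * X * g ^ 2 * X := ⟨_, rfl⟩
  have hy0 : y ≠ 0 := by
    have hg' : g ≠ 0 := by rintro rfl; simp at hg0
    rw [hy]
    exact mul_ne_zero (mul_ne_zero (mul_ne_zero h40 X_ne_zero) (pow_ne_zero 2 hg'))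
      X_ne_zero
  rw [← hy] at hw hl2 he2 hf2
  obtain ⟨w, hw'⟩ : ∃ w, w = evalMulX (4 * X * g ^ 2) invOneAdd := ⟨_, rfl⟩
  obtain ⟨j, hj⟩ : ∃ j, j = evalMulX (4 * X * g ^ 2) antiY := ⟨_, rfl⟩
  rw [← hw'] at hw hl2 he2
  rw [← hj] at hl2 he2 hf2
  have hg1 : 1 + y = g := by rw [hy]; linear_combination -hg
  rw [hg1] at hw
  have hyw : y * w ^ 2 = 4 * X ^ 2 := by
    rw [hy]; linear_combination 4 * X ^ 2 * (g * w + 1) * hw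
  have hyX : 4 * X ^ 2 * (1 + y) ^ 2 = y := by rw [hg1, hy]; ring
  have hjm : 2 * X * m = j - X * antiConst := by
    have h1 : j + X * antiConst ≠ 0 := by rw [hf2]; exact mul_ne_zero hy0 hf3
    refine mul_left_cancel₀ h1 ?_
    rw [hl1] at hl2
    linear_combination hl2 - evalMulX (4 * X * g ^ 2) diagY ^ 2 * y * hyw
  have hX := X_mem_algSeries
  have h2 : (2 : ℚ⟦X⟧) ∈ algSeries := natCast_mem _ 2
  have h4 : (4 : ℚ⟦X⟧) ∈ algSeries := natCast_mem _ 4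
  have hXb := mul_mem hX hb
  have hc : 1 - 4 * X ^ 2 * (2 * constantCoeff antiX - 2) ∈ algSeries :=
    sub_mem (one_mem _) (mul_mem (mul_mem h4 (pow_mem hX 2)) (sub_mem (mul_mem h2 hr) h2))
  have hjm' : j ∈ algSeries := by
    refine mem_algSeries_of_cubic h4 (sub_mem (mul_mem h4 hXb) h4)
      (sub_mem hc (mul_mem h4 hXb))
      (sub_mem (mul_mem hXb hc) (mul_mem (mul_mem h4 (pow_mem hX 2)) hem)) h40
      (mul_left_cancel₀ hy0 ?_)
    linear_combination 4 * he2 - (j + X * antiConst) * (hyX + 4 * y * hyw)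
  have hm' : m ∈ algSeries := by
    refine mem_algSeries_of_mul (2 * X) m (mul_mem h2 hX) (mul_ne_zero two_ne_zero X_ne_zero) ?_
    rw [hjm]
    exact sub_mem hjm' hXb
  refine ⟨hm', ?_⟩
  rw [hl1]
  exact neg_mem (add_mem (pow_mem hb 2) (mul_mem (add_mem hm' hm') hb))

theorem mem_algCoeffs_of_C_X_mul {f : ℚ⟦X⟧⟦X⟧} (h : C X * f ∈ algCoeffs) : f ∈ algCoeffs :=
  mem_algCoeffs_of_mul (C_mem_algCoeffs X_mem_algSeries) (by simp [X_ne_zero]) h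

theorem fold_mem_algCoeffs : foldX (-1) ∈ algCoeffs ∧ foldY (-1) 0 ∈ algCoeffs ∧
    foldX 1 ∈ algCoeffs ∧ (PowerSeries.mk fun n : ℕ => coneGF n n) ∈ algCoeffs := by
  have : CharZero ℚ⟦X⟧ := algebraRat.charZero _
  obtain ⟨e, he, he'⟩ := anti_cubic
  obtain ⟨hb, hr, hem⟩ := anti_params_mem he
  obtain ⟨l, hl, hl'⟩ := sym_quadratic
  obtain ⟨hm, hlm⟩ := sym_params_mem hb hr hem he' hl'
  have hx := antiX_mem hb hr hem he
  have hy := antiY_mem hb hr hem he'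
  have hX := X_mem_algCoeffs
  have ht := C_mem_algCoeffs X_mem_algSeries
  have hw := invOneAdd_mem
  have hbC := C_mem_algCoeffs hb
  have hmC := C_mem_algCoeffs hm
  have hlC := C_mem_algCoeffs hlm
  have h2 : (2 : ℚ⟦X⟧⟦X⟧) ∈ algCoeffs := natCast_mem _ 2
  have h4 : (4 : ℚ⟦X⟧⟦X⟧) ∈ algCoeffs := natCast_mem _ 4
  have h1X : 1 + X ∈ algCoeffs := add_mem (one_mem _) hX
  refine ⟨?_, ?_, ?_, ?_⟩
  · refine mem_algCoeffs_of_C_X_mul ?_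
    rw [C_X_mul_foldX_neg_one]
    exact add_mem hbC (mul_mem hX hx)
  · refine mem_algCoeffs_of_C_X_mul (mem_algCoeffs_of_C_X_mul
      (mem_algCoeffs_of_mul h1X (by simp) ?_))
    rw [show (1 + X) * (C X * (C X * foldY (-1) 0)) = X * invOneAdd - antiY by
      rw [antiY, map_pow]; ring]
    exact sub_mem (mul_mem hX hw) hy
  · have hs : symX ∈ algCoeffs := by
      refine mem_algCoeffs_of_sq (by simp [symX]) ?_
      have h1 : 1 + X ^ 2 * antiX ∈ algCoeffs := add_mem (one_mem _) (mul_mem (pow_mem hX 2) hx)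
      rw [hl]
      exact add_mem (sub_mem (pow_mem h1 2) (mul_mem (mul_mem (mul_mem h2 hmC) hX) h1))
        (mul_mem hlC (pow_mem hX 2))
    refine mem_algCoeffs_of_C_X_mul (mem_algCoeffs_of_X_mul ?_)
    rw [show X * (C X * foldX 1) = 1 - symX by rw [symX]; ring]
    exact sub_mem (one_mem _) hs
  · have hd : diagY ∈ algCoeffs := by
      refine mem_algCoeffs_of_sq (by simp [diagY]) (mem_algCoeffs_of_mul
        (f := X * invOneAdd ^ 2 - 4 * C X ^ 2) (sub_mem (mul_mem hX (pow_mem hw 2))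
          (mul_mem h4 (pow_mem ht 2))) ?_ (mem_algCoeffs_of_X_mul ?_))
      · simp only [map_sub, map_mul, map_pow, map_ofNat, constantCoeff_X, constantCoeff_C,
          zero_mul, zero_sub]
        exact neg_ne_zero.2 (mul_ne_zero (by norm_num) (pow_ne_zero 2 X_ne_zero))
      · rw [show X * ((X * invOneAdd ^ 2 - 4 * C X ^ 2) * diagY ^ 2) =
          (X ^ 2 * invOneAdd ^ 2 - 4 * C X ^ 2 * X) * diagY ^ 2 by ring, hl']
        exact add_mem (sub_mem (pow_mem hy 2) (mul_mem (mul_mem (mul_mem h2 ht) hmC) hy))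
          (mul_mem (pow_mem ht 2) hlC)
    refine mem_algCoeffs_of_C_X_mul (mem_algCoeffs_of_mul h1X (by simp) ?_)
    rw [show (1 + X) * (C X * PowerSeries.mk fun n : ℕ => coneGF n n) = diagY - 1 by
      rw [diagY]; ring]
    exact sub_mem hd (one_mem _)

theorem coneGF_self_mem (n : ℕ) : coneGF n n ∈ algSeries := by
  have := coeff_mem_of_mem_algCoeffs fold_mem_algCoeffs.2.2.2 n
  rwa [coeff_mk] at this

theorem mem_algSeries_of_add_of_sub {f g : ℚ⟦X⟧} (h : f + g ∈ algSeries)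
    (h' : f + -1 * g ∈ algSeries) : f ∈ algSeries ∧ g ∈ algSeries := by
  have : CharZero ℚ⟦X⟧ := algebraRat.charZero _
  have hf : f ∈ algSeries := by
    refine mem_algSeries_of_mul 2 f (natCast_mem _ 2) two_ne_zero ?_
    rw [show 2 * f = f + g + (f + -1 * g) by ring]
    exact add_mem h h'
  refine ⟨hf, ?_⟩
  rw [show g = f + g - f by ring]
  exact sub_mem h hf

theorem coneGF_axis_mem (n : ℕ) :
    coneGF (0 - n - 1) 0 ∈ algSeries ∧ coneGF 0 (0 - n - 1) ∈ algSeries := by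
  have h1 := coeff_mem_of_mem_algCoeffs fold_mem_algCoeffs.2.2.1 n
  have h2 := coeff_mem_of_mem_algCoeffs fold_mem_algCoeffs.1 n
  rw [foldX, coeff_mk, foldGF, one_mul] at h1
  rw [foldX, coeff_mk, foldGF] at h2
  exact mem_algSeries_of_add_of_sub h1 h2

theorem mem_algSeries_of_coneGF_eq {i j : ℤ} (h : 0 ≤ i ∨ 0 ≤ j) (hm : coneGF i j ∈ algSeries) :
    coneGF (i - 1) j + coneGF (i + 1) j + coneGF i (j - 1) + coneGF i (j + 1) ∈ algSeries := by
  refine mem_algSeries_of_mul X _ X_mem_algSeries X_ne_zero ?_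
  have heq := coneGF_eq h
  rw [eq_sub_iff_add_eq'.2 heq.symm]
  refine sub_mem hm ?_
  split_ifs
  exacts [one_mem _, zero_mem _]

theorem coneGF_mem_of_le (b : ℕ) :
    ∀ i : ℤ, i ≤ b → coneGF i b ∈ algSeries ∧ coneGF b i ∈ algSeries := by
  induction b using Nat.strong_induction_on with
  | _ b ih =>
    intro i hi
    rcases hi.eq_or_lt with rfl | hi
    · exact ⟨coneGF_self_mem b, coneGF_self_mem b⟩
    rcases b with _ | b
    · obtain ⟨n, rfl⟩ : ∃ n : ℕ, i = 0 - n - 1 := ⟨(-1 - i).toNat, by omega⟩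
      exact coneGF_axis_mem n
    have hb := ih b b.lt_succ_self
    rw [Nat.cast_succ] at hi ⊢
    rcases (Int.lt_add_one_iff.1 hi).eq_or_lt with rfl | hi
    · have h1 := mem_algSeries_of_coneGF_eq (i := b) (j := b) (by omega) (coneGF_self_mem b)
      have h2 := hb (b - 1) (by omega)
      have h3 := coeff_mem_of_mem_algCoeffs fold_mem_algCoeffs.2.1 (b + 1)
      rw [foldY, coeff_mk, foldGF, Nat.cast_succ, show (b + 1 - 0 - 1 : ℤ) = b by ring] at h3
      refine mem_algSeries_of_add_of_sub ?_ h3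
      convert sub_mem h1 (add_mem h2.1 h2.2) using 1
      ring
    have hprev : coneGF i (b - 1) ∈ algSeries ∧ coneGF (b - 1) i ∈ algSeries := by
      rcases b with _ | b
      · rw [coneGF_of_neg (by omega) (by omega), coneGF_of_neg (by omega) (by omega)]
        exact ⟨zero_mem _, zero_mem _⟩
      · rw [Nat.cast_succ, add_sub_cancel_right]
        exact ih b (by omega) i (by omega)
    have hi1 := hb i hi.le
    have hi2 := hb (i - 1) (by omega)
    have hi3 := hb (i + 1) (by omega)
    constructor
    · convert sub_mem (mem_algSeries_of_coneGF_eq (by omega) hi1.1)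
        (add_mem (add_mem hi2.1 hi3.1) hprev.1) using 1
      ring
    · convert sub_mem (mem_algSeries_of_coneGF_eq (by omega) hi1.2)
        (add_mem (add_mem hi2.2 hi3.2) hprev.2) using 1
      ring

theorem coneGF_mem_algSeries {i j : ℤ} (h : 0 ≤ i ∨ 0 ≤ j) : coneGF i j ∈ algSeries := by
  rcases le_total i j with hij | hij
  · lift j to ℕ using by omega
    exact (coneGF_mem_of_le j i hij).1
  · lift i to ℕ using by omega
    exact (coneGF_mem_of_le i j hij).2

end Conclusion

theorem square_threeQuadrant_shifted_gf_algebraic (i j : ℤ) (hC : 0 ≤ i ∨ 0 ≤ j) :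
    ∃ P : Polynomial (Polynomial ℚ), P ≠ 0 ∧
      Polynomial.eval₂ (Polynomial.coeToPowerSeries.ringHom : Polynomial ℚ →+* PowerSeries ℚ)
        (PowerSeries.mk fun n => (walkCount squareSteps coneC (-1, 0) (i, j) n : ℚ))
        P = 0 := by
  obtain ⟨P, hP, h⟩ := mem_algSeries.1 (coneGF_mem_algSeries hC)
  refine ⟨P, hP, ?_⟩
  have hφ : Polynomial.coeToPowerSeries.ringHom = algebraMap (Polynomial ℚ) ℚ⟦X⟧ :=
    RingHom.ext fun p => by
      rw [PowerSeries.algebraMap_apply', Algebra.algebraMap_self, PowerSeries.map_id]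
      rfl
  rw [hφ]
  exact h
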